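/- arXiv:1105.0455 — 6 statements merged into one kernel-verified Lean document; each statement's English description precedes it below -/
import Mathlib

section
/- Let ω be a real number, let s be a complex number with Re(s) > 0, and let 0 < γ < ∞ be a real constant. Then Re(√(ω² + s²/γ²)) ≥ (1/γ)·Re(s), where √ denotes the principal branch of the complex square root. -/
/-- The principal branch of the complex square root:
with `-π < arg z ≤ π`, `arg (csqrt z) = (1/2) * arg z`. -/
noncomputable def csqrt (z : ℂ) : ℂ := z ^ ((1 : ℂ) / 2)

theorem csqrt_sq (z : ℂ) : csqrt z ^ 2 = z := by
  simp [csqrt]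

theorem csqrt_re_nonneg (z : ℂ) : 0 ≤ (csqrt z).re := by
  rw [csqrt, one_div, Complex.cpow_inv_two_re]
  exact Real.sqrt_nonneg _

/-- A complex number in the closed right half-plane whose square is `ω² + t²`, with `ω` real and
`t` in the open right half-plane, has real part at least `Re t`. -/
theorem re_le_re_of_sq_eq_sq_add_sq {ω : ℝ} {t w : ℂ} (ht : 0 < t.re) (hw : 0 ≤ w.re)
    (h : w ^ 2 = (ω : ℂ) ^ 2 + t ^ 2) : t.re ≤ w.re := by
  have hre : w.re ^ 2 - w.im ^ 2 = ω ^ 2 + (t.re ^ 2 - t.im ^ 2) := by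
    simpa [pow_two] using congrArg Complex.re h
  have him : w.re * w.im = t.re * t.im := by
    have := congrArg Complex.im h
    simp only [pow_two, Complex.add_im, Complex.mul_im, Complex.ofReal_re, Complex.ofReal_im] at this
    linarith
  by_contra! hlt
  have hsq : w.re ^ 2 < t.re ^ 2 := by gcongr
  have him_lt : w.im ^ 2 < t.im ^ 2 := by linarith [sq_nonneg ω]
  have hprod : (w.re * w.im) ^ 2 < (t.re * t.im) ^ 2 := by
    rw [mul_pow, mul_pow]
    calc w.re ^ 2 * w.im ^ 2 ≤ t.re ^ 2 * w.im ^ 2 := by gcongr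
      _ < t.re ^ 2 * t.im ^ 2 := by gcongr
  exact hprod.ne (by rw [him])

/-- Let ω be real, `s` complex with `Re s > 0`, and `0 < γ < ∞` real.
Then `Re (√(ω² + s²/γ²)) ≥ (1/γ) Re s`. -/
theorem re_csqrt_scaled_ge (ω : ℝ) (s : ℂ) (hs : 0 < s.re) (γ : ℝ) (hγ : 0 < γ) :
    (1 / γ) * s.re ≤ (csqrt ((ω : ℂ) ^ 2 + s ^ 2 / (γ : ℂ) ^ 2)).re := by
  have h := re_le_re_of_sq_eq_sq_add_sq (ω := ω) (t := s / γ)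
    (by rw [Complex.div_ofReal_re]; positivity) (csqrt_re_nonneg _)
    ((csqrt_sq _).trans (by rw [div_pow]))
  rwa [Complex.div_ofReal_re, div_eq_inv_mul, ← one_div] at h
end

section
/- For all complex numbers s̃ with Re(s̃) > 0, one has φ(s̃) ≠ 0. (That is, the determinant function φ has no zeros in the open right half-plane.) -/
/-- The determinant function `φ(s̃) = √(1+s̃²)·√(1+μs̃²/(λ+2μ)) − (1+s̃²/2)²`
for Lamé parameters `μ > 0`, `λ > 0`. -/
noncomputable def phi (μ lam : ℝ) (s : ℂ) : ℂ :=
  csqrt (1 + s ^ 2) * csqrt (1 + (μ : ℂ) * s ^ 2 / ((lam : ℂ) + 2 * (μ : ℂ)))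
    - (1 + s ^ 2 / 2) ^ 2

/-- The imaginary part of `csqrt z` has the same sign as that of `z`. -/
theorem csqrt_re_pos_and_im_mul_pos {z : ℂ} {y : ℝ} (h : 0 < z.im * y) :
    0 < (csqrt z).re ∧ 0 < (csqrt z).im * y := by
  have hre := csqrt_re_nonneg z
  have him : 2 * (csqrt z).re * (csqrt z).im = z.im := by
    have := congrArg Complex.im (csqrt_sq z)
    rw [sq, Complex.mul_im] at this
    linarith
  have hprod : 0 < (csqrt z).re * ((csqrt z).im * y) := by
    rw [← him] at h
    linarith
  have hre' : 0 < (csqrt z).re := hre.lt_of_ne fun h0 => by simp [← h0] at hprod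
  exact ⟨hre', (mul_pos_iff_of_pos_left hre').mp hprod⟩

/-- Non-real roots of the Rayleigh cubic have real part less than `-2`. -/
theorem re_lt_neg_two_of_rayleigh_cubic {k : ℝ} {z : ℂ} (hy : z.im ≠ 0)
    (h : z ^ 3 + 8 * z ^ 2 + (24 - 16 * (k : ℂ)) * z + 16 * (1 - (k : ℂ)) = 0) :
    z.re < -2 := by
  obtain ⟨x, y⟩ := z
  have hre := congrArg Complex.re h
  have him := congrArg Complex.im h
  simp [pow_succ] at hre him hy ⊢
  have hmod : y ^ 2 = 3 * x ^ 2 + 16 * x + 24 - 16 * k := by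
    apply mul_left_cancel₀ hy
    linear_combination -him
  have hcubic : 8 * x ^ 3 + 64 * x ^ 2 + (176 - 32 * k) * x + 176 - 112 * k = 0 := by
    linear_combination -hre - (3 * x + 8) * hmod
  have hy2 : 0 < y ^ 2 := by positivity
  by_contra! hx
  have hx' : 0 ≤ x + 2 := by linarith
  nlinarith [mul_nonneg hx' (sq_nonneg (x + 1)), mul_nonneg hx' hy2.le, sq_nonneg (x + 1)]

/-- The reduced secular equation has no solution off the nonpositive real axis. -/
theorem csqrt_mul_csqrt_ne {k : ℝ} (hk : 0 < k) (hk1 : k < 1) {z : ℂ}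
    (hz : z ∈ Complex.slitPlane) :
    csqrt (1 + z) * csqrt (1 + k * z) ≠ (1 + z / 2) ^ 2 := by
  intro h
  have hz0 : z ≠ 0 := Complex.slitPlane_ne_zero hz
  have hcubic : z ^ 3 + 8 * z ^ 2 + (24 - 16 * (k : ℂ)) * z + 16 * (1 - (k : ℂ)) = 0 := by
    have hsq : (1 + z) * (1 + k * z) = (1 + z / 2) ^ 4 := by
      rw [← csqrt_sq (1 + z), ← csqrt_sq (1 + k * z), ← mul_pow, h]
      ring
    apply mul_left_cancel₀ hz0
    linear_combination -16 * hsq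
  by_cases hy : z.im = 0
  · have hx : 0 < z.re := by
      rcases hz with hz | hz
      · exact hz
      · exact absurd hy hz
    obtain ⟨x, y⟩ := z
    have hre := congrArg Complex.re hcubic
    simp only at hy hx
    subst hy
    simp [pow_succ] at hre
    have h1 : 0 < (24 - 16 * k) * x := mul_pos (by linarith) hx
    have h2 : 0 < x * x * x := by positivity
    have h3 : 0 < x * x := by positivity
    linarith
  · have hx := re_lt_neg_two_of_rayleigh_cubic hy hcubic
    have hyy : 0 < z.im * z.im := mul_self_pos.mpr hy
    obtain ⟨hp, hp'⟩ := csqrt_re_pos_and_im_mul_pos (z := 1 + z) (y := z.im) (by simpa using hyy)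
    obtain ⟨hq, hq'⟩ := csqrt_re_pos_and_im_mul_pos (z := 1 + k * z) (y := z.im)
      (by simpa [mul_assoc] using mul_pos hk hyy)
    have him : (csqrt (1 + z)).re * (csqrt (1 + k * z)).im
        + (csqrt (1 + z)).im * (csqrt (1 + k * z)).re = (1 + z.re / 2) * z.im := by
      have := congrArg Complex.im h
      rw [sq, Complex.mul_im, Complex.mul_im] at this
      simp at this
      linarith
    have hneg : (1 + z.re / 2) * (z.im * z.im) < 0 :=
      mul_neg_of_neg_of_pos (by linarith) hyy
    have hpos := add_pos (mul_pos hp hq') (mul_pos hq hp')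
    nlinarith [congrArg (· * z.im) him]

/-- For all complex `s̃` with `Re s̃ > 0`, `φ(s̃) ≠ 0`: the determinant has no
zeros in the open right half-plane. -/
theorem phi_ne_zero_of_re_pos (μ lam : ℝ) (hμ : 0 < μ) (hlam : 0 < lam)
    (s : ℂ) (hs : 0 < s.re) : phi μ lam s ≠ 0 := by
  have hz : s ^ 2 ∈ Complex.slitPlane := by
    rw [Complex.mem_slitPlane_iff, sq, Complex.mul_re, Complex.mul_im]
    by_cases hi : s.im = 0
    · left
      rw [hi]
      nlinarith
    · right
      have := mul_ne_zero hs.ne' hi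
      contrapose! this
      linarith
  have hk : 0 < μ / (lam + 2 * μ) := by positivity
  have hk1 : μ / (lam + 2 * μ) < 1 := by
    rw [div_lt_one (by positivity)]
    linarith
  have h := csqrt_mul_csqrt_ne hk hk1 hz
  push_cast at h
  rw [phi, sub_ne_zero, mul_div_right_comm]
  exact h
end

section
/- For every real λ̃ ≥ 0, the function ψ(σ) = (1−σ)(1−σ/(2+λ̃)) − (1−σ/2)⁴ satisfies ψ(0) = 0, and there exists exactly one σ₀ in the open interval (0,1) with ψ(σ₀) = 0. -/
/-- For a real parameter `λ̃ ≥ 0` (representing λ/μ), the function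
`ψ(σ) = (1−σ)(1−σ/(2+λ̃)) − (1−σ/2)⁴`. -/
noncomputable def psi (lamTilde : ℝ) (σ : ℝ) : ℝ :=
  (1 - σ) * (1 - σ / (2 + lamTilde)) - (1 - σ / 2) ^ 4

/-- The cubic cofactor of `σ` in `psi`, with `a = 1/(2+λ̃)`. -/
noncomputable def psiCofactor (a σ : ℝ) : ℝ :=
  (1 - a) - (3 / 2 - a) * σ + σ ^ 2 / 2 - σ ^ 3 / 16

theorem psi_eq_mul_psiCofactor (lamTilde σ : ℝ) :
    psi lamTilde σ = σ * psiCofactor (2 + lamTilde)⁻¹ σ := by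
  unfold psi psiCofactor
  rw [div_eq_mul_inv σ (2 + lamTilde)]
  ring

theorem psiCofactor_strictAntiOn {a : ℝ} (ha : a ≤ 1 / 2) :
    StrictAntiOn (psiCofactor a) (Set.Icc 0 1) := by
  intro x hx y hy hxy
  have hslope : 0 < (3 / 2 - a) - (x + y) / 2 + (x ^ 2 + x * y + y ^ 2) / 16 := by
    nlinarith [mul_nonneg hx.1 hy.1, sq_nonneg x, hx.1, hy.2]
  have hdiff : psiCofactor a x - psiCofactor a y =
      (y - x) * ((3 / 2 - a) - (x + y) / 2 + (x ^ 2 + x * y + y ^ 2) / 16) := by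
    unfold psiCofactor
    ring
  linarith [mul_pos (sub_pos.2 hxy) hslope]

theorem exists_psiCofactor_eq_zero {a : ℝ} (ha : a < 1) :
    ∃ σ ∈ Set.Ioo (0 : ℝ) 1, psiCofactor a σ = 0 := by
  have hcont : ContinuousOn (psiCofactor a) (Set.Icc 0 1) := by
    unfold psiCofactor
    fun_prop
  refine intermediate_value_Ioo' zero_le_one hcont ⟨?_, ?_⟩ <;> unfold psiCofactor <;> linarith

/-- For every `λ̃ ≥ 0`, `ψ(0) = 0` and there is exactly one `σ₀ ∈ (0,1)`
with `ψ(σ₀) = 0`. -/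
theorem psi_zero_and_unique_root (lamTilde : ℝ) (h : 0 ≤ lamTilde) :
    psi lamTilde 0 = 0 ∧
      ∃! σ : ℝ, σ ∈ Set.Ioo (0 : ℝ) 1 ∧ psi lamTilde σ = 0 := by
  have ha : (2 + lamTilde)⁻¹ ≤ 1 / 2 := by
    rw [one_div]
    exact inv_anti₀ two_pos (by linarith)
  refine ⟨by simp [psi], ?_⟩
  obtain ⟨σ, hσ, hzero⟩ := exists_psiCofactor_eq_zero (a := (2 + lamTilde)⁻¹) (by linarith)
  refine ⟨σ, ⟨hσ, by rw [psi_eq_mul_psiCofactor, hzero, mul_zero]⟩, ?_⟩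
  rintro τ ⟨hτ, hpsi⟩
  rw [psi_eq_mul_psiCofactor] at hpsi
  exact (psiCofactor_strictAntiOn ha).injOn (Set.Ioo_subset_Icc_self hτ)
    (Set.Ioo_subset_Icc_self hσ)
    (((mul_eq_zero.1 hpsi).resolve_left hτ.1.ne').trans hzero.symm)
end

section
/- The set of real numbers ξ̃ satisfying φ(iξ̃) = 0 is exactly {0, ξ̃₀, −ξ̃₀} for a unique real number ξ̃₀ with 0 < ξ̃₀ < 1. In particular, ξ̃ = 0 is a solution, there are exactly two solutions ±ξ̃₀ with 0 < ξ̃₀ < 1, and there are no solutions with ξ̃² ≥ 1. -/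
theorem csqrt_ofReal_of_nonneg {a : ℝ} (ha : 0 ≤ a) : csqrt (a : ℂ) = (√a : ℝ) := by
  rw [csqrt, Real.sqrt_eq_rpow, Complex.ofReal_cpow ha]
  norm_num

theorem csqrt_ofReal_of_nonpos {a : ℝ} (ha : a ≤ 0) :
    csqrt (a : ℂ) = (√(-a) : ℝ) * Complex.I := by
  have h := csqrt_ofReal_of_nonneg (neg_nonneg.mpr ha)
  rw [csqrt, Complex.ofReal_neg] at h
  have hexp : (Real.pi : ℂ) * Complex.I * (1 / 2) = Real.pi / 2 * Complex.I := by ring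
  rw [csqrt, Complex.ofReal_cpow_of_nonpos ha, h, hexp, Complex.exp_pi_div_two_mul_I]

theorem phi_I_mul_ofReal (μ lam x : ℝ) :
    phi μ lam (Complex.I * (x : ℂ)) =
      csqrt ((1 - x ^ 2 : ℝ) : ℂ) * csqrt ((1 - μ / (lam + 2 * μ) * x ^ 2 : ℝ) : ℂ)
        - (((1 - x ^ 2 / 2) ^ 2 : ℝ) : ℂ) := by
  have h : (Complex.I * (x : ℂ)) ^ 2 = -(x : ℂ) ^ 2 := by
    rw [mul_pow, Complex.I_sq]
    ring
  rw [phi, h]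
  push_cast
  congr 3 <;> ring

/-- The cubic that remains after squaring the Rayleigh equation in `t = x ^ 2` and dividing
out the root `t = 0`. -/
noncomputable def rayleighCubic (k t : ℝ) : ℝ :=
  t ^ 3 / 16 - t ^ 2 / 2 + (3 / 2 - k) * t - (1 - k)

theorem csqrt_mul_csqrt_sub_eq_zero_iff {k t : ℝ} (hk : 0 < k) (hk' : k < 1 / 2) :
    csqrt ((1 - t : ℝ) : ℂ) * csqrt ((1 - k * t : ℝ) : ℂ)
        - (((1 - t / 2) ^ 2 : ℝ) : ℂ) = 0 ↔
      t ≤ 1 ∧ t * rayleighCubic k t = 0 := by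
  rcases le_or_gt t 1 with h1 | h1
  · have ha : 0 ≤ 1 - t := by linarith
    have hb : 0 ≤ 1 - k * t := by nlinarith
    rw [csqrt_ofReal_of_nonneg ha, csqrt_ofReal_of_nonneg hb, ← Complex.ofReal_mul,
      ← Complex.ofReal_sub, Complex.ofReal_eq_zero, ← Real.sqrt_mul ha, sub_eq_zero,
      Real.sqrt_eq_iff_mul_self_eq (mul_nonneg ha hb) (sq_nonneg _)]
    unfold rayleighCubic
    constructor
    · intro h
      exact ⟨h1, by linear_combination -h⟩
    · rintro ⟨-, h⟩
      linear_combination -h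
  · refine iff_of_false (fun h => ?_) (fun h => absurd h.1 (not_le.mpr h1))
    rw [csqrt_ofReal_of_nonpos (by linarith : 1 - t ≤ 0)] at h
    have hs : 0 < √(-(1 - t)) := Real.sqrt_pos.mpr (by linarith)
    rcases le_or_gt (k * t) 1 with h2 | h2
    · rw [csqrt_ofReal_of_nonneg (by linarith : 0 ≤ 1 - k * t)] at h
      have hre := congrArg Complex.re h
      have him := congrArg Complex.im h
      simp only [Complex.sub_re, Complex.sub_im, Complex.mul_re, Complex.mul_im,
        Complex.ofReal_re, Complex.ofReal_im, Complex.I_re, Complex.I_im, Complex.zero_re,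
        Complex.zero_im] at hre him
      have ht2 : 1 - t / 2 = 0 := by
        apply pow_eq_zero_iff (two_ne_zero) |>.mp
        linarith
      have hsq : 0 < √(1 - k * t) := Real.sqrt_pos.mpr (by nlinarith)
      nlinarith [mul_pos hs hsq]
    · rw [csqrt_ofReal_of_nonpos (by linarith : 1 - k * t ≤ 0)] at h
      have hsq : 0 < √(-(1 - k * t)) := Real.sqrt_pos.mpr (by linarith)
      have hre := congrArg Complex.re h
      simp only [Complex.sub_re, Complex.mul_re, Complex.mul_im,
        Complex.ofReal_re, Complex.ofReal_im, Complex.I_re, Complex.I_im, Complex.zero_re] at hre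
      nlinarith [mul_pos hs hsq, sq_nonneg (1 - t / 2)]

theorem rayleighCubic_strictMonoOn {k : ℝ} (hk : k < 1 / 2) :
    StrictMonoOn (rayleighCubic k) (Set.Icc 0 1) := by
  rintro a ⟨ha, ha'⟩ b ⟨hb, hb'⟩ hab
  have h : 0 < (b - a) * ((a ^ 2 + a * b + b ^ 2) / 16 - (a + b) / 2 + (3 / 2 - k)) := by
    apply mul_pos (by linarith)
    nlinarith [mul_nonneg (sub_nonneg.mpr ha') (sub_nonneg.mpr hb'), sq_nonneg (a - 1),
      sq_nonneg (b - 1)]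
  unfold rayleighCubic
  linarith

theorem exists_rayleighCubic_root {k : ℝ} (hk : k < 1 / 2) :
    ∃ t : ℝ, (0 < t ∧ t < 1) ∧ rayleighCubic k t = 0 := by
  have hc : ContinuousOn (rayleighCubic k) (Set.Icc 0 1) := by
    unfold rayleighCubic
    fun_prop
  have h : (0 : ℝ) ∈ Set.Ioo (rayleighCubic k 0) (rayleighCubic k 1) := by
    unfold rayleighCubic
    constructor <;> linarith
  obtain ⟨t, ht, h0⟩ := intermediate_value_Ioo zero_le_one hc h
  exact ⟨t, ht, h0⟩

/-- The set of real `ξ̃` with `φ(iξ̃) = 0` is exactly `{0, ξ̃₀, −ξ̃₀}` for a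
unique real `ξ̃₀` with `0 < ξ̃₀ < 1`.  In particular, `ξ̃ = 0` is a solution,
there are exactly two solutions `±ξ̃₀` with `0 < ξ̃₀ < 1`, and there are no
solutions with `ξ̃² ≥ 1`. -/
theorem phi_imaginary_roots (μ lam : ℝ) (hμ : 0 < μ) (hlam : 0 < lam) :
    ∃! ξ₀ : ℝ, (0 < ξ₀ ∧ ξ₀ < 1) ∧
      {x : ℝ | phi μ lam (Complex.I * (x : ℂ)) = 0} = {0, ξ₀, -ξ₀} := by
  have hd : 0 < lam + 2 * μ := by linarith
  have hk : 0 < μ / (lam + 2 * μ) := div_pos hμ hd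
  have hk' : μ / (lam + 2 * μ) < 1 / 2 := by
    rw [div_lt_div_iff₀ hd two_pos]
    linarith
  obtain ⟨t, ⟨ht0, ht1⟩, ht⟩ := exists_rayleighCubic_root hk'
  have hs : √t ^ 2 = t := Real.sq_sqrt ht0.le
  have hs0 : 0 < √t := Real.sqrt_pos.mpr ht0
  have hset : {x : ℝ | phi μ lam (Complex.I * (x : ℂ)) = 0} = {0, √t, -√t} := by
    ext x
    simp only [Set.mem_ofPred_eq, Set.mem_insert_iff, Set.mem_singleton_iff]
    rw [phi_I_mul_ofReal, csqrt_mul_csqrt_sub_eq_zero_iff hk hk',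
      ← sq_eq_sq_iff_eq_or_eq_neg, hs]
    constructor
    · rintro ⟨hx, h⟩
      rcases mul_eq_zero.mp h with h | h
      · exact Or.inl (pow_eq_zero_iff two_ne_zero |>.mp h)
      · exact Or.inr ((rayleighCubic_strictMonoOn hk').injOn ⟨sq_nonneg x, hx⟩
          ⟨ht0.le, ht1.le⟩ (h.trans ht.symm))
    · rintro (rfl | h)
      · norm_num
      · rw [h]
        exact ⟨ht1.le, by rw [ht, mul_zero]⟩
  refine ⟨√t, ⟨⟨hs0, by nlinarith⟩, hset⟩, ?_⟩
  rintro y ⟨⟨hy, -⟩, hyset⟩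
  have hmem : y ∈ ({0, √t, -√t} : Set ℝ) := by
    rw [← hset, hyset]
    simp
  rcases hmem with h | h | h
  · exact absurd h hy.ne'
  · exact h
  · rw [Set.mem_singleton_iff] at h
    linarith
end

section
/- Let μ > 0, λ > 0, let 0 < ξ̃₀ < 1 be real with φ(iξ̃₀) = 0, and set s̃₀ = iξ̃₀. Then φ is complex-differentiable at s̃₀ and its derivative satisfies √(1+s̃₀²)·√(1+μs̃₀²/(2μ+λ))·φ′(s̃₀)/s̃₀ = 1 + μs̃₀²/(2μ+λ) + μ(1+s̃₀²)/(2μ+λ) − 2(1+s̃₀²/2)³; in particular, the right-hand side is a real number and φ′(s̃₀) is purely imaginary. -/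
lemma csqrt_mul_self (z : ℂ) : csqrt z * csqrt z = z := by
  have h := Complex.cpow_nat_inv_pow z (two_ne_zero)
  simpa [csqrt, sq] using h

lemma csqrt_ofReal {x : ℝ} (hx : 0 ≤ x) : csqrt (x : ℂ) = ((√x : ℝ) : ℂ) := by
  rw [csqrt, Real.sqrt_eq_rpow, Complex.ofReal_cpow hx]
  norm_num

lemma HasDerivAt.csqrt {f : ℂ → ℂ} {f' s : ℂ} (hf : HasDerivAt f f' s)
    (hs : f s ∈ Complex.slitPlane) :
    HasDerivAt (fun z => csqrt (f z)) (f' / (2 * _root_.csqrt (f s))) s := by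
  have h := hf.cpow_const (c := (1 : ℂ) / 2) hs
  have h0 : f s ≠ 0 := Complex.slitPlane_ne_zero hs
  have hsq := csqrt_mul_self (f s)
  have hne : _root_.csqrt (f s) ≠ 0 := fun h => h0 (by rw [← hsq, h, mul_zero])
  refine h.congr_deriv ?_
  rw [Complex.cpow_sub _ _ h0, Complex.cpow_one]
  change 1 / 2 * (_root_.csqrt (f s) / f s) * f' = _
  field_simp
  linear_combination f' * hsq

lemma hasDerivAt_phi {μ lam : ℝ} {s : ℂ} (h₁ : 1 + s ^ 2 ∈ Complex.slitPlane)
    (h₂ : 1 + (μ : ℂ) * s ^ 2 / ((lam : ℂ) + 2 * (μ : ℂ)) ∈ Complex.slitPlane) :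
    HasDerivAt (phi μ lam)
      (s * (csqrt (1 + (μ : ℂ) * s ^ 2 / ((lam : ℂ) + 2 * (μ : ℂ))) / csqrt (1 + s ^ 2)
        + (μ : ℂ) / ((lam : ℂ) + 2 * (μ : ℂ)) * (csqrt (1 + s ^ 2)
          / csqrt (1 + (μ : ℂ) * s ^ 2 / ((lam : ℂ) + 2 * (μ : ℂ))))
        - 2 * (1 + s ^ 2 / 2))) s := by
  have hsq : HasDerivAt (fun z : ℂ => z ^ 2) (2 * s) s := by
    simpa using hasDerivAt_pow 2 s
  have hA := (hsq.const_add 1).csqrt h₁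
  have hB := (((hsq.const_mul (μ : ℂ)).div_const ((lam : ℂ) + 2 * (μ : ℂ))).const_add 1).csqrt h₂
  have hC := ((hsq.div_const 2).const_add 1).pow 2
  refine ((hA.mul hB).sub hC).congr_deriv ?_
  push_cast
  ring

/-- Let `μ, λ > 0`, `0 < ξ̃₀ < 1` with `φ(iξ̃₀) = 0`, `s̃₀ = iξ̃₀`.
Then φ is complex-differentiable at `s̃₀` and
`√(1+s̃₀²)·√(1+μs̃₀²/(2μ+λ))·φ′(s̃₀)/s̃₀
  = 1 + μs̃₀²/(2μ+λ) + μ(1+s̃₀²)/(2μ+λ) − 2(1+s̃₀²/2)³`;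
the right-hand side is real and `φ′(s̃₀)` is purely imaginary. -/
theorem phi_deriv_at_generalized_eigenvalue (μ lam : ℝ) (hμ : 0 < μ) (hlam : 0 < lam)
    (ξ₀ : ℝ) (h0 : 0 < ξ₀) (h1 : ξ₀ < 1)
    (hroot : phi μ lam (Complex.I * (ξ₀ : ℂ)) = 0) :
    DifferentiableAt ℂ (phi μ lam) (Complex.I * (ξ₀ : ℂ)) ∧
    csqrt (1 + (Complex.I * (ξ₀ : ℂ)) ^ 2) *
        csqrt (1 + (μ : ℂ) * (Complex.I * (ξ₀ : ℂ)) ^ 2 / (2 * (μ : ℂ) + (lam : ℂ))) *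
        deriv (phi μ lam) (Complex.I * (ξ₀ : ℂ)) / (Complex.I * (ξ₀ : ℂ))
      = 1 + (μ : ℂ) * (Complex.I * (ξ₀ : ℂ)) ^ 2 / (2 * (μ : ℂ) + (lam : ℂ))
        + (μ : ℂ) * (1 + (Complex.I * (ξ₀ : ℂ)) ^ 2) / (2 * (μ : ℂ) + (lam : ℂ))
        - 2 * (1 + (Complex.I * (ξ₀ : ℂ)) ^ 2 / 2) ^ 3 ∧
    (1 + (μ : ℂ) * (Complex.I * (ξ₀ : ℂ)) ^ 2 / (2 * (μ : ℂ) + (lam : ℂ))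
        + (μ : ℂ) * (1 + (Complex.I * (ξ₀ : ℂ)) ^ 2) / (2 * (μ : ℂ) + (lam : ℂ))
        - 2 * (1 + (Complex.I * (ξ₀ : ℂ)) ^ 2 / 2) ^ 3).im = 0 ∧
    (deriv (phi μ lam) (Complex.I * (ξ₀ : ℂ))).re = 0 := by
  have hD : 0 < lam + 2 * μ := by positivity
  have ha : 0 < 1 - ξ₀ ^ 2 := by nlinarith
  have hb : 0 < 1 - μ * ξ₀ ^ 2 / (lam + 2 * μ) := by
    rw [sub_pos, div_lt_one hD]
    nlinarith
  have hs : (Complex.I * (ξ₀ : ℂ)) ^ 2 = ((-ξ₀ ^ 2 : ℝ) : ℂ) := by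
    rw [mul_pow, Complex.I_sq]
    push_cast
    ring
  have hs0 : Complex.I * (ξ₀ : ℂ) ≠ 0 :=
    mul_ne_zero Complex.I_ne_zero (Complex.ofReal_ne_zero.mpr h0.ne')
  have hA : 1 + (Complex.I * (ξ₀ : ℂ)) ^ 2 = ((1 - ξ₀ ^ 2 : ℝ) : ℂ) := by
    rw [hs]
    push_cast
    ring
  have hB : 1 + (μ : ℂ) * (Complex.I * (ξ₀ : ℂ)) ^ 2 / ((lam : ℂ) + 2 * (μ : ℂ))
      = ((1 - μ * ξ₀ ^ 2 / (lam + 2 * μ) : ℝ) : ℂ) := by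
    rw [hs]
    push_cast
    ring
  have hderiv := hasDerivAt_phi (μ := μ) (lam := lam) (s := Complex.I * (ξ₀ : ℂ))
    (by rw [hA]; exact Complex.ofReal_mem_slitPlane.mpr ha)
    (by rw [hB]; exact Complex.ofReal_mem_slitPlane.mpr hb)
  rw [add_comm (2 * (μ : ℂ)) (lam : ℂ)]
  refine ⟨hderiv.differentiableAt, ?_, ?_, ?_⟩
  · rw [hderiv.deriv]
    rw [phi] at hroot
    have hAA := csqrt_mul_self (1 + (Complex.I * (ξ₀ : ℂ)) ^ 2)
    have hBB := csqrt_mul_self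
      (1 + (μ : ℂ) * (Complex.I * (ξ₀ : ℂ)) ^ 2 / ((lam : ℂ) + 2 * (μ : ℂ)))
    have hA0 : csqrt (1 + (Complex.I * (ξ₀ : ℂ)) ^ 2) ≠ 0 := by
      rw [hA, csqrt_ofReal ha.le]
      exact Complex.ofReal_ne_zero.mpr (Real.sqrt_pos.mpr ha).ne'
    have hB0 : csqrt
        (1 + (μ : ℂ) * (Complex.I * (ξ₀ : ℂ)) ^ 2 / ((lam : ℂ) + 2 * (μ : ℂ))) ≠ 0 := by
      rw [hB, csqrt_ofReal hb.le]
      exact Complex.ofReal_ne_zero.mpr (Real.sqrt_pos.mpr hb).ne'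
    generalize csqrt (1 + (μ : ℂ) * (Complex.I * (ξ₀ : ℂ)) ^ 2 / ((lam : ℂ) + 2 * (μ : ℂ))) = B
      at *
    generalize csqrt (1 + (Complex.I * (ξ₀ : ℂ)) ^ 2) = A at *
    generalize Complex.I * (ξ₀ : ℂ) = s at *
    have hmul : A * B * (s * (B / A + (μ : ℂ) / ((lam : ℂ) + 2 * (μ : ℂ)) * (A / B)
        - 2 * (1 + s ^ 2 / 2))) / s
        = B * B + (μ : ℂ) / ((lam : ℂ) + 2 * (μ : ℂ)) * (A * A)
          - 2 * (1 + s ^ 2 / 2) * (A * B) := by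
      generalize (μ : ℂ) / ((lam : ℂ) + 2 * (μ : ℂ)) = k
      field_simp
    rw [hmul, hAA, hBB, sub_eq_zero.mp hroot]
    ring
  · rw [hs]
    norm_cast
  · rw [hderiv.deriv, hA, hB, csqrt_ofReal ha.le, csqrt_ofReal hb.le, hs, mul_assoc,
      Complex.I_mul_re, neg_eq_zero]
    norm_cast
end

section
/- Let μ > 0, λ > 0, let ω ≠ 0 be real, and let s be complex with Re(s) > 0. Set κ₁ = √(ω² + s²/μ), κ₂ = √(ω² + s²/(λ+2μ)), γ² = λ/(2μ+λ), and define the boundary determinant Δ = 2ω²(1−γ²)κ₁κ₂ − (κ₂² − γ²ω²)(κ₁² + ω²). Then μ(λ+2μ)Δ = 4μ²ω⁴·φ(s̃), where s̃ = s/(|ω|√μ). -/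
theorem csqrt_ofReal_sq_mul {r : ℝ} (hr : 0 < r) (z : ℂ) :
    csqrt ((r : ℂ) ^ 2 * z) = r * csqrt z := by
  rcases eq_or_ne z 0 with rfl | hz
  · simp [csqrt]
  have hr' : (r : ℂ) ≠ 0 := by exact_mod_cast hr.ne'
  have hlog : Complex.log ((r : ℂ) ^ 2 * z) = 2 * Complex.log r + Complex.log z := by
    rw [← Complex.ofReal_pow, Complex.log_ofReal_mul (pow_pos hr 2) hz, Real.log_pow,
      ← Complex.ofReal_log hr.le]
    push_cast
    rfl
  rw [csqrt, csqrt, Complex.cpow_def_of_ne_zero (mul_ne_zero (pow_ne_zero 2 hr') hz),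
    Complex.cpow_def_of_ne_zero hz, hlog, add_mul, Complex.exp_add,
    show 2 * Complex.log r * (1 / 2) = Complex.log r by ring, Complex.exp_log hr']

/-- Let `μ, λ > 0`, `ω ≠ 0` real, `Re s > 0`.  With
`κ₁ = √(ω² + s²/μ)`, `κ₂ = √(ω² + s²/(λ+2μ))`, `γ² = λ/(2μ+λ)`,
and `Δ = 2ω²(1−γ²)κ₁κ₂ − (κ₂² − γ²ω²)(κ₁² + ω²)`, one has
`μ(λ+2μ)Δ = 4μ²ω⁴·φ(s̃)` with `s̃ = s/(|ω|√μ)`. -/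
theorem boundary_determinant_scaling (μ lam : ℝ) (hμ : 0 < μ) (hlam : 0 < lam)
    (ω : ℝ) (hω : ω ≠ 0) (s : ℂ) (hs : 0 < s.re) :
    (μ : ℂ) * ((lam : ℂ) + 2 * (μ : ℂ)) *
      (2 * (ω : ℂ) ^ 2 * (1 - (lam : ℂ) / (2 * (μ : ℂ) + (lam : ℂ))) *
          csqrt ((ω : ℂ) ^ 2 + s ^ 2 / (μ : ℂ)) *
          csqrt ((ω : ℂ) ^ 2 + s ^ 2 / ((lam : ℂ) + 2 * (μ : ℂ)))
        - (csqrt ((ω : ℂ) ^ 2 + s ^ 2 / ((lam : ℂ) + 2 * (μ : ℂ))) ^ 2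
              - ((lam : ℂ) / (2 * (μ : ℂ) + (lam : ℂ))) * (ω : ℂ) ^ 2) *
          (csqrt ((ω : ℂ) ^ 2 + s ^ 2 / (μ : ℂ)) ^ 2 + (ω : ℂ) ^ 2))
    = 4 * (μ : ℂ) ^ 2 * (ω : ℂ) ^ 4 *
        phi μ lam (s / ((|ω| * Real.sqrt μ : ℝ) : ℂ)) := by
  have hμ' : (μ : ℂ) ≠ 0 := by exact_mod_cast hμ.ne'
  have hω' : (ω : ℂ) ≠ 0 := by exact_mod_cast hω
  have hM : (lam : ℂ) + 2 * μ ≠ 0 := by exact_mod_cast (by positivity : lam + 2 * μ ≠ 0)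
  have habs : ((|ω| : ℝ) : ℂ) ^ 2 = (ω : ℂ) ^ 2 := by exact_mod_cast sq_abs ω
  have hsqrt : ((Real.sqrt μ : ℝ) : ℂ) ^ 2 = μ := by exact_mod_cast Real.sq_sqrt hμ.le
  have hscaled : (s / ((|ω| * Real.sqrt μ : ℝ) : ℂ)) ^ 2 = s ^ 2 / ((ω : ℂ) ^ 2 * μ) := by
    rw [Complex.ofReal_mul, div_pow, mul_pow, habs, hsqrt]
  have hκ₁ : csqrt ((ω : ℂ) ^ 2 + s ^ 2 / μ)
      = (|ω| : ℝ) * csqrt (1 + s ^ 2 / ((ω : ℂ) ^ 2 * μ)) := by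
    rw [← csqrt_ofReal_sq_mul (abs_pos.mpr hω), habs]
    congr 1
    field_simp
  have hκ₂ : csqrt ((ω : ℂ) ^ 2 + s ^ 2 / ((lam : ℂ) + 2 * μ))
      = (|ω| : ℝ) * csqrt (1 + μ * (s ^ 2 / ((ω : ℂ) ^ 2 * μ)) / ((lam : ℂ) + 2 * μ)) := by
    rw [← csqrt_ofReal_sq_mul (abs_pos.mpr hω), habs]
    congr 1
    field_simp
  rw [csqrt_sq, csqrt_sq, hκ₁, hκ₂, phi, hscaled, add_comm (2 * (μ : ℂ))]
  generalize csqrt (1 + s ^ 2 / ((ω : ℂ) ^ 2 * μ)) = a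
  generalize csqrt (1 + μ * (s ^ 2 / ((ω : ℂ) ^ 2 * μ)) / ((lam : ℂ) + 2 * μ)) = b
  have hprod : ((|ω| : ℝ) : ℂ) * a * ((|ω| : ℝ) * b) = (ω : ℂ) ^ 2 * (a * b) := by
    rw [← habs]
    ring
  rw [mul_assoc (2 * (ω : ℂ) ^ 2 * _), hprod]
  obtain ⟨M, hMdef⟩ : ∃ M, M = (lam : ℂ) + 2 * μ := ⟨_, rfl⟩
  rw [← hMdef] at hM ⊢
  rw [eq_sub_of_add_eq hMdef.symm]
  field_simp
  ring
end
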